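/- For every probability measure ν on X² and every ℓ ∈ L, (R_ℓν)(Y_ℓ) = 1, where Y_ℓ = {(x¹,x²) ∈ X² : υ(x¹_ℓ, x²_ℓ) ≤ Σ_{ℓ'∈∂ℓ} υ(x¹_{ℓ'}, x²_{ℓ'})}. -/

import Mathlib

open MeasureTheory ENNReal Filter
open scoped Classical ENNReal

namespace DP

noncomputable section

variable {L Ξ : Type*}

/-- The discrete "metric" `υ`, valued in `ℝ≥0∞`. -/
def ups {α : Type*} (a b : α) : ℝ≥0∞ := if a = b then 0 else 1

/-- The discrete "metric" `υ`, valued in `ℝ`. -/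
def upsR {α : Type*} (a b : α) : ℝ := if a = b then 0 else 1

/-- The sub-σ-field of the product σ-field generated by the coordinates outside `D`. -/
def extCyl [MeasurableSpace Ξ] (D : Set L) : MeasurableSpace (L → Ξ) :=
  MeasurableSpace.comap (fun (x : L → Ξ) (i : (Dᶜ : Set L)) => x i.1) MeasurableSpace.pi

/-- `F_ℓ`: the sub-σ-field generated by the coordinates indexed by `L ∖ {ℓ}`. -/
def Floc [MeasurableSpace Ξ] (ℓ : L) : MeasurableSpace (L → Ξ) := extCyl {ℓ}

/-- The product σ-field `F_ℓ ⊗ F_ℓ` on `X²`. -/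
def FlocPair [MeasurableSpace Ξ] (ℓ : L) : MeasurableSpace ((L → Ξ) × (L → Ξ)) :=
  (Floc ℓ).comap Prod.fst ⊔ (Floc ℓ).comap Prod.snd

/-- The total variation distance between two measures. -/
def tvDist {E : Type*} [MeasurableSpace E] (σ ς : Measure E) : ℝ :=
  ⨆ A : {A : Set E // MeasurableSet A}, |(σ A.1).toReal - (ς A.1).toReal|

/-- `ν` is a coupling of `μ1` and `μ2`. -/
def IsCoupling {E F : Type*} [MeasurableSpace E] [MeasurableSpace F]
    (ν : Measure (E × F)) (μ1 : Measure E) (μ2 : Measure F) : Prop :=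
  ν.map Prod.fst = μ1 ∧ ν.map Prod.snd = μ2

/-- A one-site specification: a family of probability measures `π ℓ x` on `Ξ`
such that `x ↦ π ℓ x A` is `F_ℓ`-measurable. -/
structure IsSpecification [MeasurableSpace Ξ] (π : L → (L → Ξ) → Measure Ξ) : Prop where
  prob : ∀ ℓ x, IsProbabilityMeasure (π ℓ x)
  meas : ∀ (ℓ : L) (A : Set Ξ), MeasurableSet A → Measurable[Floc ℓ] fun x => π ℓ x A

/-- Consistency of `μ` with the one-site specification `π` (equation (5) of the paper). -/
def Consistent [MeasurableSpace Ξ] (π : L → (L → Ξ) → Measure Ξ)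
    (μ : Measure (L → Ξ)) : Prop :=
  ∀ (ℓ : L) (A : Set (L → Ξ)), MeasurableSet A →
    μ A = ∫⁻ y, π ℓ y {ξ : Ξ | Function.update y ℓ ξ ∈ A} ∂μ

/-- `μ(h) = sup_ℓ ∫ h(x_ℓ) dμ`. -/
def Mh [MeasurableSpace Ξ] (h : Ξ → ℝ) (μ : Measure (L → Ξ)) : ℝ≥0∞ :=
  ⨆ ℓ : L, ∫⁻ x, ENNReal.ofReal (h (x ℓ)) ∂μ

/-- `ν(I_ℓ)`. -/
def nuI [MeasurableSpace Ξ] (ν : Measure ((L → Ξ) × (L → Ξ))) (ℓ : L) : ℝ≥0∞ :=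
  ∫⁻ p, ups (p.1 ℓ) (p.2 ℓ) ∂ν

/-- `ν(I_ℓ H^i_{ℓ'})`, `i = 0,1` standing for the components `1,2`. -/
def nuIH [MeasurableSpace Ξ] (h : Ξ → ℝ) (ν : Measure ((L → Ξ) × (L → Ξ)))
    (i : Fin 2) (ℓ ℓ' : L) : ℝ≥0∞ :=
  ∫⁻ p, ups (p.1 ℓ) (p.2 ℓ) * ENNReal.ofReal (h ((if i = 0 then p.1 else p.2) ℓ')) ∂ν

/-- `γ(ν) = sup_ℓ ν(I_ℓ)`. -/
def gam [MeasurableSpace Ξ] (ν : Measure ((L → Ξ) × (L → Ξ))) : ℝ≥0∞ := ⨆ ℓ : L, nuI ν ℓ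

/-- `λ(ν) = max_i sup_{ℓ,ℓ'} ν(I_ℓ H^i_{ℓ'})`. -/
def lam [MeasurableSpace Ξ] (h : Ξ → ℝ) (ν : Measure ((L → Ξ) × (L → Ξ))) : ℝ≥0∞ :=
  ⨆ i : Fin 2, ⨆ ℓ : L, ⨆ ℓ' : L, nuIH h ν i ℓ ℓ'

/-- `γ_D(ν) = sup_{ℓ ∈ D} ν(I_ℓ)`. -/
def gamD [MeasurableSpace Ξ] (ν : Measure ((L → Ξ) × (L → Ξ))) (D : Set L) : ℝ≥0∞ :=
  ⨆ ℓ : D, nuI ν ℓ.1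

/-- `λ_D(ν) = max_i sup_{ℓ,ℓ' ∈ D} ν(I_ℓ H^i_{ℓ'})`. -/
def lamD [MeasurableSpace Ξ] (h : Ξ → ℝ) (ν : Measure ((L → Ξ) × (L → Ξ))) (D : Set L) : ℝ≥0∞ :=
  ⨆ i : Fin 2, ⨆ ℓ : D, ⨆ ℓ' : D, nuIH h ν i ℓ.1 ℓ'.1

/-- The reconstruction map `R_ℓ` built from a family of couplings `ϱ`. -/
def Rmap [MeasurableSpace Ξ] (ϱ : L → (L → Ξ) → (L → Ξ) → Measure (Ξ × Ξ))
    (ℓ : L) (ν : Measure ((L → Ξ) × (L → Ξ))) : Measure ((L → Ξ) × (L → Ξ)) :=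
  ν.bind fun p =>
    (ϱ ℓ p.1 p.2).map fun q => (Function.update p.1 ℓ q.1, Function.update p.2 ℓ q.2)

/-- A jointly measurable family of optimal couplings of `π ℓ x` and `π ℓ y`. -/
structure OptCoupling [MeasurableSpace Ξ] (π : L → (L → Ξ) → Measure Ξ)
    (ϱ : L → (L → Ξ) → (L → Ξ) → Measure (Ξ × Ξ)) : Prop where
  coupling : ∀ ℓ x y, IsCoupling (ϱ ℓ x y) (π ℓ x) (π ℓ y)
  meas : ∀ (ℓ : L) (B : Set (Ξ × Ξ)), MeasurableSet B →
    Measurable[FlocPair ℓ] fun p : (L → Ξ) × (L → Ξ) => ϱ ℓ p.1 p.2 B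
  opt : ∀ ℓ x y, ENNReal.ofReal (tvDist (π ℓ x) (π ℓ y)) = ∫⁻ q, ups q.1 q.2 ∂(ϱ ℓ x y)

/-- The constant `A = 2Δ^{χ+1}/(1-κ̄)`. -/
def Abar (Δ χ : ℕ) (κb : ℝ) : ℝ := 2 * (Δ : ℝ) ^ (χ + 1) / (1 - κb)

/-- The threshold `K_*`. -/
def Kstar (Δ χ : ℕ) (κb cb : ℝ) : ℝ :=
  max (4 * (Δ : ℝ) ^ (χ + 1) / (cb * (1 - κb)))
    (2 * (Δ : ℝ) ^ (χ + 1) * (2 * (Δ : ℝ) ^ (χ - 1) + 1 - cb * (Δ : ℝ) ^ χ) /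
      ((1 - κb) ^ 2 * (1 - cb * (Δ : ℝ) ^ χ)))

/-- The spectral radius `r_K` of the matrix `M(K)`. -/
def rK (Δ χ : ℕ) (κb cb K : ℝ) : ℝ :=
  (κb + Abar Δ χ κb / K + cb * (Δ : ℝ) ^ χ +
    Real.sqrt ((κb + Abar Δ χ κb / K - cb * (Δ : ℝ) ^ χ) ^ 2 +
      8 * (Δ : ℝ) ^ χ * (Abar Δ χ κb / K))) / 2

/-- The matrix `M(K)` with entries in `ℝ≥0∞`. -/
def MK (Δ χ : ℕ) (κb cb K : ℝ) : Matrix (Fin 2) (Fin 2) ℝ≥0∞ :=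
  !![ENNReal.ofReal (κb + Abar Δ χ κb / K), ENNReal.ofReal (2 * Abar Δ χ κb / K);
     ENNReal.ofReal ((Δ : ℝ) ^ (χ - 1)), ENNReal.ofReal (cb * (Δ : ℝ) ^ χ)]

/-- The class `Π(h,K,κ,c)` of one-site specifications, with `κ̄ ≤ κb`, `c̄ ≤ cb`
understood via the separate hypotheses on `κb`, `cb`. -/
structure InPi [MeasurableSpace Ξ] (G : SimpleGraph L) [∀ v, Fintype (G.neighborSet v)]
    (π : L → (L → Ξ) → Measure Ξ) (h : Ξ → ℝ) (K : ℝ) (κ c : L → L → ℝ) : Prop where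
  spec : IsSpecification π
  tv_bound : ∀ (ℓ : L) (x y : L → Ξ),
    (∀ ℓ' ∈ G.neighborFinset ℓ, h (x ℓ') ≤ K) →
    (∀ ℓ' ∈ G.neighborFinset ℓ, h (y ℓ') ≤ K) →
    tvDist (π ℓ x) (π ℓ y) ≤ ∑ ℓ' ∈ G.neighborFinset ℓ, κ ℓ ℓ' * upsR (x ℓ') (y ℓ')
  h_bound : ∀ (ℓ : L) (x : L → Ξ),
    ∫⁻ ξ, ENNReal.ofReal (h ξ) ∂(π ℓ x) ≤
      ENNReal.ofReal (1 + ∑ ℓ' ∈ G.neighborFinset ℓ, c ℓ ℓ' * h (x ℓ'))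

end
end DP

namespace DP

section

variable {L Ξ : Type*} [MeasurableSpace Ξ]

theorem ups_le_one {α : Type*} (a b : α) : ups a b ≤ 1 := by
  unfold ups; split_ifs <;> simp

theorem ups_eq_zero_iff {α : Type*} {a b : α} : ups a b = 0 ↔ a = b := by
  simp [ups]

theorem ups_of_ne {α : Type*} {a b : α} (h : a ≠ b) : ups a b = 1 := if_neg h

theorem measurable_ups [MeasurableEq Ξ] {α : Type*} [MeasurableSpace α] {f g : α → Ξ}
    (hf : Measurable f) (hg : Measurable g) : Measurable fun a => ups (f a) (g a) :=
  Measurable.ite (measurableSet_eq_fun hf hg) measurable_const measurable_const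

theorem Floc_le_pi (ℓ : L) : Floc ℓ ≤ (MeasurableSpace.pi : MeasurableSpace (L → Ξ)) :=
  Measurable.comap_le (measurable_pi_lambda _ fun i => measurable_pi_apply i.1)

theorem FlocPair_le_prod (ℓ : L) :
    FlocPair ℓ ≤ (inferInstance : MeasurableSpace ((L → Ξ) × (L → Ξ))) :=
  sup_le_sup (MeasurableSpace.comap_mono (Floc_le_pi ℓ))
    (MeasurableSpace.comap_mono (Floc_le_pi ℓ))

theorem tvDist_self {E : Type*} [MeasurableSpace E] (σ : Measure E) : tvDist σ σ = 0 := by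
  simp [tvDist]

theorem IsCoupling.isProbabilityMeasure {E F : Type*} [MeasurableSpace E] [MeasurableSpace F]
    {ν : Measure (E × F)} {μ1 : Measure E} {μ2 : Measure F} [IsProbabilityMeasure μ1]
    (h : IsCoupling ν μ1 μ2) : IsProbabilityMeasure ν := by
  refine ⟨?_⟩
  rw [← Set.preimage_univ (f := Prod.fst), ← Measure.map_apply measurable_fst MeasurableSet.univ,
    h.1, measure_univ]

/-- Replace the coordinates at `ℓ` of a pair of configurations. -/
noncomputable def updatePair (ℓ : L) (p : (L → Ξ) × (L → Ξ)) (q : Ξ × Ξ) : (L → Ξ) × (L → Ξ) :=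
  (Function.update p.1 ℓ q.1, Function.update p.2 ℓ q.2)

theorem measurable_uncurry_updatePair (ℓ : L) :
    Measurable fun r : ((L → Ξ) × (L → Ξ)) × (Ξ × Ξ) => updatePair ℓ r.1 r.2 := by
  unfold updatePair
  exact (measurable_update'.comp (by fun_prop :
      Measurable fun r : ((L → Ξ) × (L → Ξ)) × (Ξ × Ξ) => (r.1.1, r.2.1))).prodMk
    (measurable_update'.comp (by fun_prop :
      Measurable fun r : ((L → Ξ) × (L → Ξ)) × (Ξ × Ξ) => (r.1.2, r.2.2)))

theorem measurable_updatePair (ℓ : L) (p : (L → Ξ) × (L → Ξ)) : Measurable (updatePair ℓ p) :=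
  (measurable_uncurry_updatePair ℓ).comp measurable_prodMk_left

variable {π : L → (L → Ξ) → Measure Ξ} {ϱ : L → (L → Ξ) → (L → Ξ) → Measure (Ξ × Ξ)}

theorem OptCoupling.isProbabilityMeasure (hπ : IsSpecification π) (hϱ : OptCoupling π ϱ)
    (ℓ : L) (x y : L → Ξ) : IsProbabilityMeasure (ϱ ℓ x y) :=
  have := hπ.prob ℓ x
  (hϱ.coupling ℓ x y).isProbabilityMeasure

theorem OptCoupling.measurable (hϱ : OptCoupling π ϱ) (ℓ : L) :
    Measurable fun p : (L → Ξ) × (L → Ξ) => ϱ ℓ p.1 p.2 :=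
  Measure.measurable_of_measurable_coe _ fun B hB =>
    (hϱ.meas ℓ B hB).mono (FlocPair_le_prod ℓ) le_rfl

theorem OptCoupling.measurable_map_updatePair (hπ : IsSpecification π) (hϱ : OptCoupling π ϱ)
    (ℓ : L) :
    Measurable fun p : (L → Ξ) × (L → Ξ) => (ϱ ℓ p.1 p.2).map (updatePair ℓ p) := by
  let κ : ProbabilityTheory.Kernel ((L → Ξ) × (L → Ξ)) (Ξ × Ξ) :=
    ⟨fun p => ϱ ℓ p.1 p.2, hϱ.measurable ℓ⟩
  have : ProbabilityTheory.IsMarkovKernel κ := ⟨fun p => hϱ.isProbabilityMeasure hπ ℓ p.1 p.2⟩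
  refine Measure.measurable_of_measurable_coe _ fun s hs => ?_
  simp_rw [Measure.map_apply (measurable_updatePair ℓ _) hs]
  exact ProbabilityTheory.Kernel.measurable_kernel_prodMk_left (κ := κ)
    (measurable_uncurry_updatePair ℓ hs)

/-- An optimal coupling of two equal measures is carried by the diagonal. -/
theorem OptCoupling.ae_eq_of_eq [MeasurableEq Ξ] (hϱ : OptCoupling π ϱ) {ℓ : L} {x y : L → Ξ}
    (h : π ℓ x = π ℓ y) : ∀ᵐ q ∂(ϱ ℓ x y), q.1 = q.2 := by
  have h0 := hϱ.opt ℓ x y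
  rw [h, tvDist_self, ENNReal.ofReal_zero, eq_comm,
    lintegral_eq_zero_iff (measurable_ups measurable_fst measurable_snd)] at h0
  filter_upwards [h0] with q hq
  exact ups_eq_zero_iff.1 hq

/-- `Rmap ϱ ℓ ν` gives full mass to a measurable set which, for every starting pair, contains
almost every updated pair. -/
theorem OptCoupling.Rmap_eq_one (hπ : IsSpecification π) (hϱ : OptCoupling π ϱ)
    (ν : Measure ((L → Ξ) × (L → Ξ))) [IsProbabilityMeasure ν] (ℓ : L)
    {Y : Set ((L → Ξ) × (L → Ξ))} (hY : MeasurableSet Y)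
    (h : ∀ p : (L → Ξ) × (L → Ξ), ∀ᵐ q ∂(ϱ ℓ p.1 p.2), updatePair ℓ p q ∈ Y) :
    Rmap ϱ ℓ ν Y = 1 := by
  have hmass (p : (L → Ξ) × (L → Ξ)) : (ϱ ℓ p.1 p.2).map (updatePair ℓ p) Y = 1 := by
    have := hϱ.isProbabilityMeasure hπ ℓ p.1 p.2
    rw [Measure.map_apply (measurable_updatePair ℓ p) hY, ← mem_ae_iff_prob_eq_one
      (measurable_updatePair ℓ p hY)]
    exact h p
  calc Rmap ϱ ℓ ν Y = ∫⁻ p, (ϱ ℓ p.1 p.2).map (updatePair ℓ p) Y ∂ν :=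
        Measure.bind_apply hY (hϱ.measurable_map_updatePair hπ ℓ).aemeasurable
    _ = 1 := by simp [hmass]

end

end DP

/-- `(R_ℓ ν)(Y_ℓ) = 1`, where
`Y_ℓ = {(x¹,x²) : υ(x¹_ℓ,x²_ℓ) ≤ Σ_{ℓ'∈∂ℓ} υ(x¹_{ℓ'},x²_{ℓ'})}`.  Here the
specification is assumed to depend on `x` only through the coordinates on `∂ℓ`. -/
theorem Rmap_Y_eq_one {L Ξ : Type*} [Countable L] [MeasurableSpace Ξ]
    [StandardBorelSpace Ξ] (G : SimpleGraph L) [∀ v, Fintype (G.neighborSet v)]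
    (π : L → (L → Ξ) → Measure Ξ) (hπ : DP.IsSpecification π)
    (hloc : ∀ (ℓ : L) (x y : L → Ξ),
      (∀ ℓ' ∈ G.neighborFinset ℓ, x ℓ' = y ℓ') → π ℓ x = π ℓ y)
    (ϱ : L → (L → Ξ) → (L → Ξ) → Measure (Ξ × Ξ)) (hϱ : DP.OptCoupling π ϱ)
    (ν : Measure ((L → Ξ) × (L → Ξ))) [IsProbabilityMeasure ν] (ℓ : L) :
    DP.Rmap ϱ ℓ ν
      {p : (L → Ξ) × (L → Ξ) |
        DP.ups (p.1 ℓ) (p.2 ℓ) ≤ ∑ ℓ' ∈ G.neighborFinset ℓ, DP.ups (p.1 ℓ') (p.2 ℓ')} = 1 := by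
  have hY : MeasurableSet {p : (L → Ξ) × (L → Ξ) |
      DP.ups (p.1 ℓ) (p.2 ℓ) ≤ ∑ ℓ' ∈ G.neighborFinset ℓ, DP.ups (p.1 ℓ') (p.2 ℓ')} :=
    have hm (i : L) : Measurable fun p : (L → Ξ) × (L → Ξ) => DP.ups (p.1 i) (p.2 i) :=
      DP.measurable_ups (by fun_prop) (by fun_prop)
    measurableSet_le (hm ℓ) (Finset.measurable_sum _ fun i _ => hm i)
  refine hϱ.Rmap_eq_one hπ ν ℓ hY fun p => ?_
  by_cases h : ∀ ℓ' ∈ G.neighborFinset ℓ, p.1 ℓ' = p.2 ℓ'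
  · filter_upwards [hϱ.ae_eq_of_eq (hloc ℓ p.1 p.2 h)] with q hq
    simp [DP.updatePair, hq, DP.ups]
  · push Not at h
    obtain ⟨i, hi, hne⟩ := h
    have hiℓ : i ≠ ℓ := (G.ne_of_adj ((G.mem_neighborFinset ℓ i).1 hi)).symm
    refine Eventually.of_forall fun q => (DP.ups_le_one _ _).trans ?_
    calc (1 : ℝ≥0∞) = DP.ups ((DP.updatePair ℓ p q).1 i) ((DP.updatePair ℓ p q).2 i) := by
          simp [DP.updatePair, hiℓ, DP.ups_of_ne hne]
      _ ≤ _ := Finset.single_le_sum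
          (f := fun j => DP.ups ((DP.updatePair ℓ p q).1 j) ((DP.updatePair ℓ p q).2 j))
          (fun _ _ => zero_le) hi
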